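/- Let n = 2^k be a power of two, let κ ∈ (0,1), and let p(κ) ∈ (0,1/2] be the probability with binary entropy h(p(κ)) = κ. For ε ∈ (0,1), set ε̃ = ε²/(2n) and let R = R_{ε̃}(p(κ)) = { j ∈ {1,…,n} : H(Y(p(κ))_j | Y(p(κ))^{j-1}) ≥ 1 − ε̃ }, where Y(p(κ)) = X(p(κ))·G_n and X(p(κ)) is i.i.d. Bernoulli(p(κ)). Then: (i) for any p with h(p) ≥ κ, if X is i.i.d. Bernoulli(p) and Y = X·G_n, the distribution of (Y_j : j ∈ R) on F_2^{|R|} is within ε in total-variation/ℓ1 distance of the uniform distribution on F_2^{|R|}; (ii) |R|/n → κ as k → ∞. -/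

import Mathlib

open MeasureTheory ProbabilityTheory Filter
open scoped Classical

/-- Shannon entropy (in bits) of a finite-valued random variable `X` on `(Ω, μ)`:
`H(X) = ∑ₓ P(X = x) log₂ (1 / P(X = x))`. -/
noncomputable def shEnt {Ω : Type*} [MeasurableSpace Ω] (μ : Measure Ω)
    {α : Type*} [Fintype α] (X : Ω → α) : ℝ :=
  (∑ x : α, Real.negMulLog ((μ (X ⁻¹' {x})).toReal)) / Real.log 2

/-- Conditional Shannon entropy (in bits) of discrete random variables:
`H(X | Y) = H(X, Y) - H(Y)`. -/
noncomputable def cEnt {Ω : Type*} [MeasurableSpace Ω] (μ : Measure Ω)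
    {α β : Type*} [Fintype α] [Fintype β] (X : Ω → α) (Y : Ω → β) : ℝ :=
  shEnt μ (fun ω => (X ω, Y ω)) - shEnt μ Y

/-- Shannon entropy (in bits) of a distribution on a finite set. -/
noncomputable def distEnt {α : Type*} [MeasurableSpace α] [Fintype α] (ν : Measure α) : ℝ :=
  (∑ x : α, Real.negMulLog ((ν {x}).toReal)) / Real.log 2

/-- The binary entropy function `h(p) = -p log₂ p - (1-p) log₂ (1-p)`. -/
noncomputable def binEnt (p : ℝ) : ℝ :=
  (Real.negMulLog p + Real.negMulLog (1 - p)) / Real.log 2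

/-- The Bernoulli(p) distribution on `F₂` (probability `p` of the outcome `1`). -/
noncomputable def bern (p : ℝ) : Measure (ZMod 2) :=
  ENNReal.ofReal (1 - p) • Measure.dirac 0 + ENNReal.ofReal p • Measure.dirac 1

/-- `G k` is the `2^k × 2^k` matrix over `F₂` given by the `k`-fold Kronecker power of
`[[1,0],[1,1]]`, in closed form: the `(i,j)` entry is `1` iff each binary digit of `j`
is dominated by the corresponding binary digit of `i` (for the single factor
`[[1,0],[1,1]]`, the `(a,b)` entry is `1` iff the bit `b` is dominated by the bit `a`,
and the Kronecker power multiplies these bitwise conditions). -/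
def G (k : ℕ) : Matrix (Fin (2 ^ k)) (Fin (2 ^ k)) (ZMod 2) :=
  Matrix.of fun i j => if j.val &&& i.val = j.val then 1 else 0

/-- The set `R_thr` of column indices whose conditional entropy
`H(Y_j | Y^{j-1}) ` is at least `thr`, for `Y = X0 ⬝ G_n`. -/
noncomputable def highSet {Ω0 : Type*} [MeasurableSpace Ω0] (μ0 : Measure Ω0) (k : ℕ)
    (X0 : Ω0 → Fin (2 ^ k) → ZMod 2) (thr : ℝ) : Finset (Fin (2 ^ k)) :=
  Finset.univ.filter fun j =>
    thr ≤ cEnt μ0 (fun ω => Matrix.vecMul (X0 ω) (G k) j)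
      (fun ω (i : Fin j.val) => Matrix.vecMul (X0 ω) (G k) (i.castLE j.isLt.le))

/-- Entropy in nats contributed by splitting the mass `a + b` into `a` and `b`. -/
noncomputable def splitEnt (a b : ℝ) : ℝ :=
  Real.negMulLog a + Real.negMulLog b - Real.negMulLog (a + b)

lemma splitEnt_comm (a b : ℝ) : splitEnt a b = splitEnt b a := by
  unfold splitEnt; rw [add_comm b a]; ring

lemma splitEnt_zero_left (b : ℝ) : splitEnt 0 b = 0 := by simp [splitEnt]

lemma splitEnt_mul (c a b : ℝ) : splitEnt (c * a) (c * b) = c * splitEnt a b := by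
  unfold splitEnt
  rw [← mul_add, Real.negMulLog_mul, Real.negMulLog_mul, Real.negMulLog_mul]; ring

lemma splitEnt_eq_binEntropy {a b : ℝ} (h : a + b ≠ 0) :
    splitEnt a b = (a + b) * Real.binEntropy (a / (a + b)) := by
  have h1 : a = (a + b) * (a / (a + b)) := by field_simp
  have h2 : b = (a + b) * (1 - a / (a + b)) := by field_simp; ring
  have h3 : splitEnt (a / (a + b)) (1 - a / (a + b)) = Real.binEntropy (a / (a + b)) := by
    rw [Real.binEntropy_eq_negMulLog_add_negMulLog_one_sub]; simp [splitEnt]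
  calc splitEnt a b = splitEnt ((a + b) * (a / (a + b))) ((a + b) * (1 - a / (a + b))) := by
        rw [← h1, ← h2]
    _ = _ := by rw [splitEnt_mul, h3]

lemma splitEnt_le_log_two {a b : ℝ} (ha : 0 ≤ a) (hb : 0 ≤ b) :
    splitEnt a b ≤ (a + b) * Real.log 2 := by
  rcases (add_nonneg ha hb).eq_or_lt with h | h
  · have : a = 0 := by linarith
    have : b = 0 := by linarith
    subst a; subst b; simp [splitEnt]
  · rw [splitEnt_eq_binEntropy h.ne']
    exact mul_le_mul_of_nonneg_left Real.binEntropy_le_log_two h.le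

lemma two_mul_log_two_le_binEntropy {x : ℝ} (h0 : 0 ≤ x) (h1 : x ≤ 1 / 2) :
    2 * x * Real.log 2 ≤ Real.binEntropy x := by
  have hm0 : (0 : ℝ) ∈ Set.Icc (0 : ℝ) 1 := by simp
  have hm1 : (2⁻¹ : ℝ) ∈ Set.Icc (0 : ℝ) 1 := by constructor <;> norm_num
  have := Real.strictConcave_binEntropy.concaveOn.2 hm0 hm1 (show 0 ≤ 1 - 2 * x by linarith)
    (show 0 ≤ 2 * x by linarith) (by ring)
  have e : 2 * x * 2⁻¹ = x := by ring
  simpa [e] using this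

lemma splitEnt_lower {a b : ℝ} (ha : 0 ≤ a) (hb : 0 ≤ b) :
    (a + b - |a - b|) * Real.log 2 ≤ splitEnt a b := by
  wlog hab : a ≤ b generalizing a b
  · rw [splitEnt_comm, abs_sub_comm, add_comm]; exact this hb ha (le_of_not_ge hab)
  rcases (add_nonneg ha hb).eq_or_lt with h | h
  · have : a = 0 := by linarith
    have : b = 0 := by linarith
    subst a; subst b; simp [splitEnt]
  · rw [splitEnt_eq_binEntropy h.ne', abs_of_nonpos (by linarith)]
    have := two_mul_log_two_le_binEntropy (x := a / (a + b)) (by positivity)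
      (by rw [div_le_div_iff₀ h (by norm_num)]; linarith)
    calc _ = (a + b) * (2 * (a / (a + b)) * Real.log 2) := by field_simp; ring
      _ ≤ _ := mul_le_mul_of_nonneg_left this h.le

lemma splitEnt_le_gibbs {a b q : ℝ} (ha : 0 ≤ a) (hb : 0 ≤ b) (hq0 : 0 ≤ q) (hq1 : q ≤ 1)
    (h0 : q = 0 → a = 0) (h1 : q = 1 → b = 0) :
    splitEnt a b ≤ -(a * Real.log q) - b * Real.log (1 - q) := by
  have key : ∀ x r s : ℝ, 0 ≤ x → 0 < s → 0 ≤ r → (r = 0 → x = 0) →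
      Real.negMulLog x + x * Real.log s + x * Real.log r ≤ s * r - x := by
    intro x r s hx hs hr h
    rcases hx.eq_or_lt with rfl | hx
    · simp; positivity
    have hr : 0 < r := lt_of_le_of_ne hr (fun h' => hx.ne' (h h'.symm))
    have := Real.log_le_sub_one_of_pos (x := s * r / x) (by positivity)
    rw [Real.log_div (by positivity) (by positivity), Real.log_mul hs.ne' hr.ne'] at this
    have h2 := mul_le_mul_of_nonneg_left this hx.le
    have h3 : x * (s * r / x - 1) = s * r - x := by field_simp
    rw [h3] at h2
    unfold Real.negMulLog; nlinarith
  rcases (add_nonneg ha hb).eq_or_lt with h | h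
  · have : a = 0 := by linarith
    have : b = 0 := by linarith
    subst a; subst b; simp [splitEnt]
  have k1 := key a q (a + b) ha h hq0 h0
  have k2 := key b (1 - q) (a + b) hb h (by linarith) (fun h => h1 (by linarith))
  have : splitEnt a b = Real.negMulLog a + Real.negMulLog b + (a + b) * Real.log (a + b) := by
    simp only [splitEnt, Real.negMulLog]; ring
  rw [this]; nlinarith

lemma splitEnt_eq_gibbs {a b : ℝ} (ha : 0 ≤ a) (hb : 0 ≤ b) :
    splitEnt a b = -(a * Real.log (a / (a + b))) - b * Real.log (1 - a / (a + b)) := by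
  rcases ha.eq_or_lt with rfl | ha
  · simp [splitEnt]
  rcases hb.eq_or_lt with rfl | hb
  · simp [splitEnt, ha.ne']
  have h : 0 < a + b := by positivity
  have h2 : 1 - a / (a + b) = b / (a + b) := by field_simp; ring
  rw [h2, Real.log_div ha.ne' h.ne', Real.log_div hb.ne' h.ne']
  simp only [splitEnt, Real.negMulLog]; ring

lemma sum_splitEnt_le {ι : Type*} (s : Finset ι) (a b : ι → ℝ) (ha : ∀ i ∈ s, 0 ≤ a i)
    (hb : ∀ i ∈ s, 0 ≤ b i) :
    ∑ i ∈ s, splitEnt (a i) (b i) ≤ splitEnt (∑ i ∈ s, a i) (∑ i ∈ s, b i) := by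
  have hA := Finset.sum_nonneg ha
  have hB := Finset.sum_nonneg hb
  rw [splitEnt_eq_gibbs hA hB, Finset.sum_mul, Finset.sum_mul, ← Finset.sum_neg_distrib,
    ← Finset.sum_sub_distrib]
  rcases (add_nonneg hA hB).eq_or_lt with h | h
  · have h1 : ∑ i ∈ s, a i = 0 := by linarith
    have h2 : ∑ i ∈ s, b i = 0 := by linarith
    rw [Finset.sum_eq_zero_iff_of_nonneg ha] at h1
    rw [Finset.sum_eq_zero_iff_of_nonneg hb] at h2
    exact Finset.sum_le_sum fun i hi => by simp [h1 i hi, h2 i hi, splitEnt]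
  refine Finset.sum_le_sum fun i hi => splitEnt_le_gibbs (ha i hi) (hb i hi) (by positivity)
    (div_le_one_of_le₀ (by linarith) h.le) (fun h0 => ?_) (fun h1 => ?_)
  · have h1 : ∑ i ∈ s, a i = 0 := by
      rcases div_eq_zero_iff.1 h0 with h | h' <;> linarith
    rw [Finset.sum_eq_zero_iff_of_nonneg ha] at h1
    exact h1 i hi
  · have h2 : ∑ i ∈ s, b i = 0 := by
      rw [div_eq_one_iff_eq h.ne'] at h1; linarith
    rw [Finset.sum_eq_zero_iff_of_nonneg hb] at h2
    exact h2 i hi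

lemma splitEnt_upper {a b l : ℝ} (ha : 0 ≤ a) (hb : 0 ≤ b) (hl : 0 < l) :
    splitEnt a b ≤ l * (a + b) + (a + b - |a - b|) / (2 * l) := by
  wlog hab : a ≤ b generalizing a b
  · rw [splitEnt_comm, abs_sub_comm, add_comm a b]; exact this hb ha (le_of_not_ge hab)
  rcases ha.eq_or_lt with rfl | ha
  · rw [splitEnt_zero_left, abs_of_nonpos (by linarith)]
    simp; positivity
  have hb : 0 < b := by linarith
  have h : 0 < a + b := by positivity
  have e : splitEnt a b = a * Real.log ((a + b) / a) + b * Real.log ((a + b) / b) := by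
    rw [Real.log_div h.ne' ha.ne', Real.log_div h.ne' hb.ne']
    simp only [splitEnt, Real.negMulLog]; ring
  have h1 : b * Real.log ((a + b) / b) ≤ a := by
    have := mul_le_mul_of_nonneg_left
      (Real.log_le_sub_one_of_pos (x := (a + b) / b) (by positivity)) hb.le
    refine this.trans (le_of_eq ?_); field_simp; ring
  have h2 : a * Real.log ((a + b) / a) ≤ 2 * (√(a * (a + b)) - a) := by
    have hs : Real.log ((a + b) / a) = 2 * Real.log (√((a + b) / a)) := by
      rw [Real.log_sqrt (by positivity)]; ring
    have := mul_le_mul_of_nonneg_left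
      (Real.log_le_sub_one_of_pos (x := √((a + b) / a)) (by positivity)) ha.le
    have h3 : a * √((a + b) / a) = √(a * (a + b)) := by
      rw [← Real.sqrt_sq ha.le, ← Real.sqrt_mul (by positivity), Real.sqrt_sq ha.le]
      congr 1; field_simp
    rw [hs]; nlinarith
  have h4 : 2 * √(a * (a + b)) ≤ l * (a + b) + a / l := by
    rw [Real.sqrt_mul ha.le]
    have e1 := Real.sq_sqrt ha.le
    have e2 := Real.sq_sqrt h.le
    have e3 := sq_nonneg (l * √(a + b) - √a)
    have : l * (a + b) + a / l = (l ^ 2 * (a + b) + a) / l := by field_simp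
    rw [this, le_div_iff₀ hl]
    nlinarith
  have h5 : (a + b - |a - b|) / (2 * l) = a / l := by
    rw [abs_of_nonpos (by linarith)]; field_simp; ring
  rw [h5, e]; linarith

/-- The average of `f` over the `2 ^ k` nodes at depth `k` of the binary tree. -/
noncomputable def levelAvg (k : ℕ) (f : ℕ → ℝ) : ℝ := (∑ j ∈ Finset.range (2 ^ k), f j) / 2 ^ k

lemma sum_range_two_pow_succ (k : ℕ) (f : ℕ → ℝ) :
    ∑ j ∈ Finset.range (2 ^ (k + 1)), f j
      = ∑ j ∈ Finset.range (2 ^ k), (f (2 * j) + f (2 * j + 1)) := by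
  have : ∀ n, ∑ j ∈ Finset.range (2 * n), f j
      = ∑ j ∈ Finset.range n, (f (2 * j) + f (2 * j + 1)) := by
    intro n
    induction n with
    | zero => simp
    | succ n ih =>
      rw [Finset.sum_range_succ, ← ih, show 2 * (n + 1) = 2 * n + 1 + 1 by ring,
        Finset.sum_range_succ, Finset.sum_range_succ]
      ring
  rw [pow_succ, mul_comm, this]

lemma levelAvg_succ (k : ℕ) (f : ℕ → ℝ) :
    levelAvg (k + 1) f = levelAvg k (fun j => (f (2 * j) + f (2 * j + 1)) / 2) := by
  unfold levelAvg
  rw [sum_range_two_pow_succ, ← Finset.sum_div, pow_succ]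
  field_simp

lemma levelAvg_mono (k : ℕ) {f g : ℕ → ℝ} (h : ∀ j, f j ≤ g j) : levelAvg k f ≤ levelAvg k g :=
  div_le_div_of_nonneg_right (Finset.sum_le_sum fun j _ => h j) (by positivity)

lemma levelAvg_const (k : ℕ) (c : ℝ) : levelAvg k (fun _ => c) = c := by
  simp [levelAvg]

lemma levelAvg_add (k : ℕ) (f g : ℕ → ℝ) :
    levelAvg k (fun j => f j + g j) = levelAvg k f + levelAvg k g := by
  simp [levelAvg, Finset.sum_add_distrib, add_div]

lemma levelAvg_const_mul (k : ℕ) (c : ℝ) (f : ℕ → ℝ) :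
    levelAvg k (fun j => c * f j) = c * levelAvg k f := by
  simp [levelAvg, ← Finset.mul_sum, mul_div_assoc]

lemma levelAvg_nonneg (k : ℕ) {f : ℕ → ℝ} (h : ∀ j, 0 ≤ f j) : 0 ≤ levelAvg k f := by
  simpa [levelAvg_const] using levelAvg_mono k h

lemma levelAvg_indicator (k : ℕ) (p : ℕ → Prop) :
    levelAvg k (fun j => if p j then 1 else 0)
      = (((Finset.range (2 ^ k)).filter p).card : ℝ) / 2 ^ k := by
  simp [levelAvg]

/-- A process on the binary tree that is squared along left edges and at most roughly doubled
along right edges. -/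
structure SquareDoubleTree (T : ℕ → ℕ → ℝ) : Prop where
  nonneg : ∀ k j, 0 ≤ T k j
  le_one : ∀ k j, T k j ≤ 1
  left_le : ∀ k j, T (k + 1) (2 * j) ≤ T k j ^ 2
  right_le : ∀ k j, T (k + 1) (2 * j + 1) ≤ 2 * T k j - T k j ^ 2

lemma SquareDoubleTree.tendsto_variance {T : ℕ → ℕ → ℝ} (hT : SquareDoubleTree T) :
    Tendsto (fun k => levelAvg k (fun j => (T k j * (1 - T k j)) ^ 2)) atTop (nhds 0) := by
  set Φ : ℕ → ℝ := fun k => levelAvg k (fun j => 2 * T k j - T k j ^ 2) with hΦ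
  have step : ∀ k, levelAvg k (fun j => (T k j * (1 - T k j)) ^ 2) ≤ Φ k - Φ (k + 1) := by
    intro k
    have : Φ (k + 1) + levelAvg k (fun j => (T k j * (1 - T k j)) ^ 2) ≤ Φ k := by
      simp only [hΦ]
      rw [levelAvg_succ, ← levelAvg_add]
      refine levelAvg_mono k fun j => ?_
      have h0 := hT.nonneg k j
      have h1 := hT.le_one k j
      have mono : ∀ x y : ℝ, 0 ≤ x → x ≤ y → y ≤ 1 → 2 * x - x ^ 2 ≤ 2 * y - y ^ 2 := by
        intro x y _ _ _; nlinarith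
      have ha := mono _ _ (hT.nonneg _ _) (hT.left_le k j) (by nlinarith)
      have hb := mono _ _ (hT.nonneg _ _) (hT.right_le k j) (by nlinarith [sq_nonneg (1 - T k j)])
      nlinarith
    linarith
  have hΦ0 : ∀ k, 0 ≤ Φ k := fun k => levelAvg_nonneg k fun j => by
    have h0 := hT.nonneg k j
    have h1 := hT.le_one k j
    nlinarith
  have hsummable : Summable (fun k => levelAvg k (fun j => (T k j * (1 - T k j)) ^ 2)) := by
    refine summable_of_sum_range_le (c := Φ 0) (fun k => levelAvg_nonneg k fun j => sq_nonneg _)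
      fun n => ?_
    have : ∑ i ∈ Finset.range n, (Φ i - Φ (i + 1)) = Φ 0 - Φ n := Finset.sum_range_sub' Φ n
    calc _ ≤ ∑ i ∈ Finset.range n, (Φ i - Φ (i + 1)) := Finset.sum_le_sum fun i _ => step i
      _ ≤ Φ 0 := by rw [this]; linarith [hΦ0 n]
  exact hsummable.tendsto_atTop_zero

/-- The fourth root. -/
noncomputable def fourthRoot (t : ℝ) : ℝ := √(√t)

lemma fourthRoot_nonneg (t : ℝ) : 0 ≤ fourthRoot t := Real.sqrt_nonneg _

lemma fourthRoot_mono {s t : ℝ} (h : s ≤ t) : fourthRoot s ≤ fourthRoot t :=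
  Real.sqrt_le_sqrt (Real.sqrt_le_sqrt h)

lemma fourthRoot_mul {s : ℝ} (t : ℝ) (h : 0 ≤ s) :
    fourthRoot (s * t) = fourthRoot s * fourthRoot t := by
  unfold fourthRoot; rw [Real.sqrt_mul h, Real.sqrt_mul (Real.sqrt_nonneg _)]

lemma fourthRoot_one : fourthRoot 1 = 1 := by simp [fourthRoot]

lemma fourthRoot_two_le : fourthRoot 2 ≤ 6 / 5 := by
  unfold fourthRoot
  rw [Real.sqrt_le_left (by norm_num), Real.sqrt_le_left (by norm_num)]; norm_num

lemma fourthRoot_le_quarter {t : ℝ} (h : t ≤ 1 / 256) : fourthRoot t ≤ 1 / 4 := by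
  unfold fourthRoot
  rw [Real.sqrt_le_left (by norm_num), Real.sqrt_le_left (by norm_num)]; linarith

/-- Upper bound for the fraction of depth-`N` descendants, of a node with value `t`, whose
value exceeds `θ`, where `c` stands for `θ⁻¹`. -/
noncomputable def escapeBound (c : ℝ) (N : ℕ) (t : ℝ) : ℝ :=
  min 1 (256 * t + (29 / 40) ^ N * fourthRoot (c * t))

lemma escapeBound_mono {c : ℝ} (hc : 0 ≤ c) (N : ℕ) {s t : ℝ} (h : s ≤ t) :
    escapeBound c N s ≤ escapeBound c N t := by
  unfold escapeBound
  have := fourthRoot_mono (mul_le_mul_of_nonneg_left h hc)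
  gcongr

lemma escapeBound_step {c t : ℝ} (hc : 0 ≤ c) (N : ℕ) (h0 : 0 ≤ t) :
    (escapeBound c N (t ^ 2) + escapeBound c N (2 * t - t ^ 2)) / 2 ≤ escapeBound c (N + 1) t := by
  refine le_min ?_ ?_
  · have h1 : escapeBound c N (t ^ 2) ≤ 1 := min_le_left _ _
    have h2 : escapeBound c N (2 * t - t ^ 2) ≤ 1 := min_le_left _ _
    linarith
  have hr := fourthRoot_nonneg (c * t)
  rcases le_or_gt t (1 / 256) with ht | ht
  · have h1 : escapeBound c N (t ^ 2) ≤ _ := min_le_right _ _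
    have h2 : escapeBound c N (2 * t - t ^ 2) ≤ _ := min_le_right _ _
    have h3 : fourthRoot (c * t ^ 2) ≤ 1 / 4 * fourthRoot (c * t) := by
      rw [show c * t ^ 2 = t * (c * t) by ring, fourthRoot_mul _ h0]
      exact mul_le_mul_of_nonneg_right (fourthRoot_le_quarter ht) hr
    have h4 : fourthRoot (c * (2 * t - t ^ 2)) ≤ 6 / 5 * fourthRoot (c * t) := by
      refine (fourthRoot_mono (t := 2 * (c * t))
        (by nlinarith [mul_nonneg hc (sq_nonneg t)])).trans ?_
      rw [fourthRoot_mul _ (by norm_num)]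
      exact mul_le_mul_of_nonneg_right fourthRoot_two_le hr
    have hp : (0 : ℝ) ≤ (29 / 40) ^ N := by positivity
    have h5 := mul_le_mul_of_nonneg_left h3 hp
    have h6 := mul_le_mul_of_nonneg_left h4 hp
    rw [pow_succ _ N]
    linarith
  · have h1 : escapeBound c N (t ^ 2) ≤ 1 := min_le_left _ _
    have h2 : escapeBound c N (2 * t - t ^ 2) ≤ 1 := min_le_left _ _
    have : 0 ≤ (29 / 40 : ℝ) ^ (N + 1) * fourthRoot (c * t) := by positivity
    linarith

lemma SquareDoubleTree.levelAvg_escapeBound {T : ℕ → ℕ → ℝ} (hT : SquareDoubleTree T) {c : ℝ}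
    (hc : 0 ≤ c) (m N i : ℕ) :
    levelAvg (m + N) (fun j => escapeBound c i (T (m + N) j))
      ≤ levelAvg m (fun j => escapeBound c (N + i) (T m j)) := by
  induction N generalizing i with
  | zero => simp
  | succ N ih =>
    rw [← add_assoc, levelAvg_succ]
    refine le_trans (levelAvg_mono _ fun j => ?_) ((ih (i + 1)).trans (le_of_eq ?_))
    · refine le_trans ?_ (escapeBound_step hc i (hT.nonneg (m + N) j))
      have := escapeBound_mono hc i (hT.left_le (m + N) j)
      have := escapeBound_mono hc i (hT.right_le (m + N) j)
      linarith
    · congr! 3; ring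

lemma one_le_escapeBound_zero {θ t : ℝ} (hθ : 0 < θ) (h : θ < t) : 1 ≤ escapeBound θ⁻¹ 0 t := by
  refine le_min le_rfl ?_
  have : 1 ≤ fourthRoot (θ⁻¹ * t) := by
    rw [← fourthRoot_one]
    apply fourthRoot_mono
    rw [inv_mul_eq_div, le_div_iff₀ hθ]; linarith
  have : 0 < t := hθ.trans h
  simp; linarith

/-- Fast polarization: at least a fraction close to that of the nodes at depth `m` with value at
most `δ` have most of their depth-`N` descendants at most `θ`. -/
lemma SquareDoubleTree.fast {T : ℕ → ℕ → ℝ} (hT : SquareDoubleTree T) {θ δ : ℝ}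
    (hθ : 0 < θ) (hδ : 0 ≤ δ) (m N : ℕ) :
    levelAvg m (fun j => if T m j ≤ δ then 1 else 0) - 256 * δ - (29 / 40) ^ N * fourthRoot θ⁻¹
      ≤ levelAvg (m + N) (fun j => if T (m + N) j ≤ θ then 1 else 0) := by
  have hc : 0 ≤ θ⁻¹ := by positivity
  have h1 : 1 - levelAvg (m + N) (fun j => escapeBound θ⁻¹ 0 (T (m + N) j))
      ≤ levelAvg (m + N) (fun j => if T (m + N) j ≤ θ then 1 else 0) := by
    rw [sub_le_iff_le_add, ← levelAvg_add]
    refine (levelAvg_const (m + N) 1).symm.le.trans (levelAvg_mono _ fun j => ?_)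
    split_ifs with h
    · have := escapeBound_mono hc 0 (hT.nonneg (m + N) j)
      have h3 : 0 ≤ escapeBound θ⁻¹ 0 0 := by
        simp [escapeBound, fourthRoot]
      linarith
    · have := one_le_escapeBound_zero hθ (lt_of_not_ge h)
      linarith
  have h2 := hT.levelAvg_escapeBound hc m N 0
  have h3 : levelAvg m (fun j => escapeBound θ⁻¹ (N + 0) (T m j))
      + levelAvg m (fun j => if T m j ≤ δ then 1 else 0)
      ≤ 1 + (256 * δ + (29 / 40) ^ N * fourthRoot θ⁻¹) := by
    rw [← levelAvg_add]
    refine (levelAvg_mono _ fun j => ?_).trans (levelAvg_const m _).le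
    have hf := fourthRoot_nonneg θ⁻¹
    have hp : (0 : ℝ) ≤ (29 / 40) ^ N * fourthRoot θ⁻¹ := by positivity
    have hb1 : escapeBound θ⁻¹ (N + 0) (T m j) ≤ 1 := min_le_left _ _
    have hb2 : escapeBound θ⁻¹ (N + 0) (T m j) ≤ _ := min_le_right _ _
    split_ifs with h
    · have : fourthRoot (θ⁻¹ * T m j) ≤ fourthRoot θ⁻¹ :=
        fourthRoot_mono (mul_le_of_le_one_right hc (hT.le_one m j))
      have := mul_le_mul_of_nonneg_left this (show (0 : ℝ) ≤ (29 / 40) ^ N by positivity)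
      simp only [add_zero] at *
      linarith
    · linarith
  linarith

lemma SquareDoubleTree.le_levelAvg_small {T H : ℕ → ℕ → ℝ} (hT : SquareDoubleTree T) {κ e : ℝ}
    (hH1 : ∀ k j, H k j ≤ 1) (hH : ∀ k j l, 0 < l → H k j ≤ 2 * l + (1 - T k j) / l)
    (hκ : ∀ k, levelAvg k (H k) = κ) (he : 0 < e) :
    ∀ᶠ m in atTop, κ - 4 * e ≤ levelAvg m (fun j => if T m j ≤ e / 256 then 1 else 0) := by
  set C : ℝ := ((e / 256) ^ 2 * e ^ 3)⁻¹ with hC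
  have hC0 : 0 < C := by positivity
  have key : ∀ m, κ ≤ levelAvg m (fun j => if T m j ≤ e / 256 then 1 else 0) + 3 * e
      + C * levelAvg m (fun j => (T m j * (1 - T m j)) ^ 2) := by
    intro m
    rw [← hκ m, ← levelAvg_const m (3 * e), ← levelAvg_const_mul, ← levelAvg_add, ← levelAvg_add]
    refine levelAvg_mono m fun j => ?_
    have h0 := hT.nonneg m j
    have h1 := hT.le_one m j
    have hV : 0 ≤ C * (T m j * (1 - T m j)) ^ 2 := by positivity
    split_ifs with h
    · linarith [hH1 m j]
    · refine (hH m j e he).trans ?_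
      push Not at h
      have : 1 - T m j ≤ e ^ 2 + e * (C * (T m j * (1 - T m j)) ^ 2) := by
        rcases le_or_gt (1 - T m j) (e ^ 2) with h' | h'
        · have := mul_nonneg he.le hV; linarith
        · have hq : e * (C * (T m j * (1 - T m j)) ^ 2)
              = (T m j / (e / 256)) ^ 2 * ((1 - T m j) / e ^ 2) * (1 - T m j) := by
            rw [hC]; field_simp
          have h2 : 1 ≤ T m j / (e / 256) := by rw [le_div_iff₀ (by positivity)]; linarith
          have h3 : 1 ≤ (1 - T m j) / e ^ 2 := by rw [le_div_iff₀ (by positivity)]; linarith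
          have h4 : 1 ≤ (T m j / (e / 256)) ^ 2 * ((1 - T m j) / e ^ 2) :=
            one_le_mul_of_one_le_of_one_le (one_le_pow₀ h2) h3
          have h5 : 0 ≤ 1 - T m j := by linarith
          rw [hq]
          have := mul_le_mul_of_nonneg_right h4 h5
          have := sq_nonneg e
          linarith
      have h2 : (1 - T m j) / e ≤ e + C * (T m j * (1 - T m j)) ^ 2 := by
        rw [div_le_iff₀ he]; linarith
      linarith
  have hlim := (hT.tendsto_variance.const_mul C)
  rw [mul_zero] at hlim
  filter_upwards [hlim.eventually (gt_mem_nhds he)] with m hm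
  linarith [key m]

/-- Polarization with thresholds approaching `1` at rate `2 ^ (-k)`. -/
theorem SquareDoubleTree.tendsto_levelAvg {T H : ℕ → ℕ → ℝ} (hT : SquareDoubleTree T) {κ ε : ℝ}
    (hH1 : ∀ k j, H k j ≤ 1) (hHT : ∀ k j, 1 - T k j ≤ H k j)
    (hH : ∀ k j l, 0 < l → H k j ≤ 2 * l + (1 - T k j) / l)
    (hκ : ∀ k, levelAvg k (H k) = κ) (hε0 : 0 < ε) (hε1 : ε < 1) :
    Tendsto (fun k => levelAvg k (fun j => if 1 - ε ^ 2 / (2 * 2 ^ k) ≤ H k j then 1 else 0))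
      atTop (nhds κ) := by
  have hθlim : Tendsto (fun k : ℕ => ε ^ 2 / (2 * 2 ^ k)) atTop (nhds 0) := by
    have := (tendsto_pow_atTop_nhds_zero_of_lt_one (r := (1 / 2 : ℝ)) (by norm_num)
      (by norm_num)).const_mul (ε ^ 2 / 2)
    rw [mul_zero] at this
    refine this.congr fun k => ?_
    rw [one_div, inv_pow]; field_simp
  refine tendsto_order.2 ⟨fun a ha => ?_, fun b hb => ?_⟩
  · set e := (κ - a) / 10 with he_def
    have he : 0 < e := by rw [he_def]; linarith
    obtain ⟨m, hm⟩ := (hT.le_levelAvg_small hH1 hH hκ he).exists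
    set c := fourthRoot (2 * 2 ^ m / ε ^ 2) with hc
    have hlim := (tendsto_pow_atTop_nhds_zero_of_lt_one (r := (87 / 100 : ℝ)) (by norm_num)
      (by norm_num)).const_mul c
    rw [mul_zero] at hlim
    obtain ⟨N₀, hN₀⟩ := eventually_atTop.1 (hlim.eventually (gt_mem_nhds he))
    refine eventually_atTop.2 ⟨m + N₀, fun k hk => ?_⟩
    obtain ⟨N, rfl⟩ : ∃ N, k = m + N := ⟨k - m, by omega⟩
    have hN := hN₀ N (by omega)
    have hθ : 0 < ε ^ 2 / (2 * 2 ^ (m + N)) := by positivity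
    have hfast := hT.fast hθ (δ := e / 256) (by positivity) m N
    have hroot : (29 / 40 : ℝ) ^ N * fourthRoot (ε ^ 2 / (2 * 2 ^ (m + N)))⁻¹
        ≤ c * (87 / 100) ^ N := by
      have hpow : ∀ n : ℕ, fourthRoot (2 ^ n) = fourthRoot 2 ^ n := by
        intro n
        induction n with
        | zero => simp [fourthRoot_one]
        | succ n ih => rw [pow_succ, fourthRoot_mul _ (by positivity), ih, pow_succ]
      have e1 : (ε ^ 2 / (2 * 2 ^ (m + N)))⁻¹ = (2 * 2 ^ m / ε ^ 2) * 2 ^ N := by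
        rw [pow_add]; field_simp
      rw [e1, fourthRoot_mul _ (by positivity), hpow, ← hc]
      have h1 : fourthRoot 2 ^ N ≤ (6 / 5) ^ N :=
        pow_le_pow_left₀ (fourthRoot_nonneg _) fourthRoot_two_le N
      have h2 : (29 / 40 : ℝ) ^ N * (6 / 5) ^ N = (87 / 100) ^ N := by
        rw [← mul_pow]; norm_num
      have hc0 : 0 ≤ c := fourthRoot_nonneg _
      calc (29 / 40 : ℝ) ^ N * (c * fourthRoot 2 ^ N) ≤ (29 / 40 : ℝ) ^ N * (c * (6 / 5) ^ N) := by
            gcongr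
        _ = c * (87 / 100) ^ N := by rw [← h2]; ring
    have hcmp : levelAvg (m + N) (fun j => if T (m + N) j ≤ ε ^ 2 / (2 * 2 ^ (m + N)) then 1 else 0)
        ≤ levelAvg (m + N)
          (fun j => if 1 - ε ^ 2 / (2 * 2 ^ (m + N)) ≤ H (m + N) j then 1 else 0) := by
      refine levelAvg_mono _ fun j => ?_
      have := hHT (m + N) j
      split_ifs with h1 h2 <;> first | (exfalso; linarith) | norm_num
    linarith
  · have hlim : Tendsto (fun k : ℕ => b * (1 - ε ^ 2 / (2 * 2 ^ k))) atTop (nhds b) := by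
      simpa using (hθlim.const_sub 1).const_mul b
    filter_upwards [hlim.eventually (lt_mem_nhds hb)] with k hk
    have hθ1 : ε ^ 2 / (2 * 2 ^ k) < 1 := by
      have : (1 : ℝ) ≤ 2 ^ k := one_le_pow₀ (by norm_num)
      rw [div_lt_one (by positivity)]; nlinarith
    have : (1 - ε ^ 2 / (2 * 2 ^ k)) *
        levelAvg k (fun j => if 1 - ε ^ 2 / (2 * 2 ^ k) ≤ H k j then 1 else 0) ≤ κ := by
      rw [← levelAvg_const_mul, ← hκ k]
      refine levelAvg_mono k fun j => ?_
      have h1 := hHT k j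
      have h2 := hT.le_one k j
      split_ifs with h <;> linarith
    nlinarith

section FiniteInformation

variable {S S' β γ : Type*}

/-- Total `g`-weight of the fiber of `V` over `b`. -/
noncomputable def mass [Fintype S] (g : S → ℝ) (V : S → β) (b : β) : ℝ :=
  ∑ s ∈ Finset.univ.filter (fun s => V s = b), g s

lemma mass_eq_sum_ite [Fintype S] (g : S → ℝ) (V : S → β) (b : β) :
    mass g V b = ∑ s, if V s = b then g s else 0 := by
  rw [mass, Finset.sum_filter]

lemma mass_nonneg [Fintype S] {g : S → ℝ} (hg : ∀ s, 0 ≤ g s) (V : S → β) (b : β) :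
    0 ≤ mass g V b :=
  Finset.sum_nonneg fun s _ => hg s

lemma sum_mass [Fintype S] [Fintype β] (g : S → ℝ) (V : S → β) : ∑ b, mass g V b = ∑ s, g s :=
  Finset.sum_fiberwise _ _ _

lemma mass_add [Fintype S] (g g' : S → ℝ) (V : S → β) (b : β) :
    mass (fun s => g s + g' s) V b = mass g V b + mass g' V b := Finset.sum_add_distrib

lemma sum_fiber_eq_sum_image [Fintype S] [Fintype β] (F : Finset S → ℝ) (hF : F ∅ = 0)
    (V : S → β) :
    ∑ b, F (Finset.univ.filter fun s => V s = b)
      = ∑ A ∈ Finset.univ.image (fun s => Finset.univ.filter fun s' => V s' = V s), F A := by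
  have himg : Finset.univ.image (fun s => Finset.univ.filter fun s' => V s' = V s)
      = (Finset.univ.image V).image (fun b => Finset.univ.filter fun s' => V s' = b) := by
    rw [Finset.image_image]; rfl
  rw [himg, Finset.sum_image]
  · symm
    apply Finset.sum_subset (Finset.subset_univ _)
    intro b _ hb
    rw [Finset.filter_eq_empty_iff.2, hF]
    intro s _ hs
    exact hb (Finset.mem_image.2 ⟨s, Finset.mem_univ _, hs⟩)
  · intro b hb c _ hbc
    obtain ⟨s, -, rfl⟩ := Finset.mem_image.1 (Finset.mem_coe.1 hb)
    have : s ∈ Finset.univ.filter fun s' => V s' = c := by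
      dsimp only at hbc; rw [← hbc]; simp
    simpa using this

/-- A sum over the fibers of a map depends only on the kernel of the map. -/
lemma sum_fiber_congr [Fintype S] [Fintype β] [Fintype γ] (F : Finset S → ℝ) (hF : F ∅ = 0)
    {V : S → β} {W : S → γ} (h : ∀ s s', V s = V s' ↔ W s = W s') :
    ∑ b, F (Finset.univ.filter fun s => V s = b)
      = ∑ c, F (Finset.univ.filter fun s => W s = c) := by
  rw [sum_fiber_eq_sum_image F hF V, sum_fiber_eq_sum_image F hF W]
  simp only [h]

/-- Entropy in nats of `V` under the weight `P`. -/
noncomputable def ent [Fintype S] [Fintype β] (P : S → ℝ) (V : S → β) : ℝ :=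
  ∑ b, Real.negMulLog (mass P V b)

/-- The restriction of the weight `P` to the event `U = u`. -/
noncomputable def slice (P : S → ℝ) (U : S → ZMod 2) (u : ZMod 2) (s : S) : ℝ :=
  if U s = u then P s else 0

/-- Conditional entropy in nats of the bit `U` given `V`. -/
noncomputable def bitEnt [Fintype S] [Fintype β] (P : S → ℝ) (U : S → ZMod 2) (V : S → β) : ℝ :=
  ∑ b, splitEnt (mass (slice P U 0) V b) (mass (slice P U 1) V b)

/-- Expected bias of the bit `U` given `V`. -/
noncomputable def bitBias [Fintype S] [Fintype β] (P : S → ℝ) (U : S → ZMod 2) (V : S → β) : ℝ :=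
  ∑ b, |mass (slice P U 0) V b - mass (slice P U 1) V b|

lemma ent_congr [Fintype S] [Fintype β] [Fintype γ] (P : S → ℝ) {V : S → β} {W : S → γ}
    (h : ∀ s s', V s = V s' ↔ W s = W s') :
    ent P V = ent P W :=
  sum_fiber_congr (fun A => Real.negMulLog (∑ s ∈ A, P s)) (by simp) h

lemma bitBias_congr [Fintype S] [Fintype β] [Fintype γ] (P : S → ℝ) (U : S → ZMod 2) {V : S → β}
    {W : S → γ}
    (h : ∀ s s', V s = V s' ↔ W s = W s') : bitBias P U V = bitBias P U W :=
  sum_fiber_congr (fun A => |∑ s ∈ A, slice P U 0 s - ∑ s ∈ A, slice P U 1 s|) (by simp) h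

lemma zmod_two_cases (u : ZMod 2) : u = 0 ∨ u = 1 := by
  fin_cases u
  · exact Or.inl rfl
  · exact Or.inr rfl

lemma sum_zmod_two (f : ZMod 2 → ℝ) : ∑ u, f u = f 0 + f 1 := Fin.sum_univ_two f

lemma slice_nonneg {P : S → ℝ} (hP : ∀ s, 0 ≤ P s) (U : S → ZMod 2) (u : ZMod 2) (s : S) :
    0 ≤ slice P U u s := by unfold slice; split_ifs; exacts [hP s, le_rfl]

lemma slice_add (P : S → ℝ) (U : S → ZMod 2) (s : S) : slice P U 0 s + slice P U 1 s = P s := by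
  unfold slice
  rcases zmod_two_cases (U s) with h | h <;> simp [h]

lemma mass_slice_add [Fintype S] (P : S → ℝ) (U : S → ZMod 2) (V : S → β) (b : β) :
    mass (slice P U 0) V b + mass (slice P U 1) V b = mass P V b := by
  rw [← mass_add]; simp only [slice_add]

lemma sum_mass_slice_add [Fintype S] [Fintype β] (P : S → ℝ) (U : S → ZMod 2) (V : S → β) :
    ∑ b, (mass (slice P U 0) V b + mass (slice P U 1) V b) = ∑ s, P s := by
  simp only [mass_slice_add, sum_mass]

/-- Chain rule for adjoining one bit. -/
lemma ent_adjoin [Fintype S] [Fintype β] [Fintype γ] (P : S → ℝ) (U : S → ZMod 2) (V : S → β)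
    {W : S → γ}
    (h : ∀ s s', W s = W s' ↔ V s = V s' ∧ U s = U s') :
    ent P W = ent P V + bitEnt P U V := by
  rw [ent_congr P (W := fun s => (V s, U s)) (by intro s s'; rw [h, Prod.mk.injEq])]
  unfold ent bitEnt
  rw [Fintype.sum_prod_type, ← Finset.sum_add_distrib]
  refine Finset.sum_congr rfl fun b _ => ?_
  have hm : ∀ u, mass P (fun s => (V s, U s)) (b, u) = mass (slice P U u) V b := by
    intro u
    rw [mass_eq_sum_ite, mass_eq_sum_ite]
    refine Finset.sum_congr rfl fun s _ => ?_
    simp only [Prod.mk.injEq, slice, ite_and]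
  rw [sum_zmod_two, hm, hm, splitEnt, mass_slice_add]; ring

lemma bitEnt_le_log_two [Fintype S] [Fintype β] {P : S → ℝ} (hP : ∀ s, 0 ≤ P s)
    (hP1 : ∑ s, P s = 1) (U : S → ZMod 2)
    (V : S → β) : bitEnt P U V ≤ Real.log 2 := by
  refine (Finset.sum_le_sum fun b _ => splitEnt_le_log_two (mass_nonneg (slice_nonneg hP U 0) V b)
    (mass_nonneg (slice_nonneg hP U 1) V b)).trans (le_of_eq ?_)
  rw [← Finset.sum_mul, sum_mass_slice_add, hP1, one_mul]

lemma bitEnt_lower [Fintype S] [Fintype β] {P : S → ℝ} (hP : ∀ s, 0 ≤ P s) (hP1 : ∑ s, P s = 1)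
    (U : S → ZMod 2)
    (V : S → β) : (1 - bitBias P U V) * Real.log 2 ≤ bitEnt P U V := by
  refine le_trans (le_of_eq ?_) (Finset.sum_le_sum fun b _ =>
    splitEnt_lower (mass_nonneg (slice_nonneg hP U 0) V b) (mass_nonneg (slice_nonneg hP U 1) V b))
  rw [← Finset.sum_mul, Finset.sum_sub_distrib, sum_mass_slice_add, hP1]; rfl

lemma bitEnt_upper [Fintype S] [Fintype β] {P : S → ℝ} (hP : ∀ s, 0 ≤ P s) (hP1 : ∑ s, P s = 1)
    (U : S → ZMod 2)
    (V : S → β) {l : ℝ} (hl : 0 < l) : bitEnt P U V ≤ l + (1 - bitBias P U V) / (2 * l) := by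
  refine (Finset.sum_le_sum fun b _ => splitEnt_upper (mass_nonneg (slice_nonneg hP U 0) V b)
    (mass_nonneg (slice_nonneg hP U 1) V b) hl).trans (le_of_eq ?_)
  rw [Finset.sum_add_distrib, ← Finset.mul_sum, ← Finset.sum_div, Finset.sum_sub_distrib,
    sum_mass_slice_add, hP1, mul_one]; rfl

lemma bitBias_nonneg [Fintype S] [Fintype β] (P : S → ℝ) (U : S → ZMod 2) (V : S → β) :
    0 ≤ bitBias P U V :=
  Finset.sum_nonneg fun _ _ => abs_nonneg _

lemma abs_sub_le_add_of_nonneg {a b : ℝ} (ha : 0 ≤ a) (hb : 0 ≤ b) : |a - b| ≤ a + b := by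
  rw [abs_le]; constructor <;> linarith

lemma bitBias_le_one [Fintype S] [Fintype β] {P : S → ℝ} (hP : ∀ s, 0 ≤ P s) (hP1 : ∑ s, P s = 1)
    (U : S → ZMod 2)
    (V : S → β) : bitBias P U V ≤ 1 := by
  rw [← hP1, ← sum_mass_slice_add P U V]
  exact Finset.sum_le_sum fun b _ => abs_sub_le_add_of_nonneg
    (mass_nonneg (slice_nonneg hP U 0) V b) (mass_nonneg (slice_nonneg hP U 1) V b)

/-- Conditioning on less increases the entropy. -/
lemma bitEnt_le_of_coarser [Fintype S] [Fintype β] [Fintype γ] {P : S → ℝ} (hP : ∀ s, 0 ≤ P s)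
    (U : S → ZMod 2) {V : S → β}
    {W : S → γ} (f : β → γ) (h : ∀ s, W s = f (V s)) : bitEnt P U V ≤ bitEnt P U W := by
  have hm : ∀ g : S → ℝ, ∀ c, mass g W c
      = ∑ b ∈ Finset.univ.filter (fun b => f b = c), mass g V b := by
    intro g c
    rw [Finset.sum_filter]
    simp only [mass_eq_sum_ite, h]
    have : ∀ b, (if f b = c then ∑ s, (if V s = b then g s else 0) else 0)
        = ∑ s, if V s = b then (if f (V s) = c then g s else 0) else 0 := by
      intro b
      by_cases hb : f b = c
      · simp only [hb, if_true]
        refine Finset.sum_congr rfl fun s _ => ?_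
        by_cases hs : V s = b <;> simp [hs, hb]
      · simp only [hb, if_false]
        symm; apply Finset.sum_eq_zero; intro s _
        by_cases hs : V s = b <;> simp [hs, hb]
    simp only [this]
    rw [Finset.sum_comm]
    simp
  unfold bitEnt
  rw [← Finset.sum_fiberwise Finset.univ f]
  refine Finset.sum_le_sum fun c _ => ?_
  rw [hm, hm]
  exact sum_splitEnt_le _ _ _ (fun b _ => mass_nonneg (slice_nonneg hP U 0) V b)
    (fun b _ => mass_nonneg (slice_nonneg hP U 1) V b)

/-- Adding independent noise does not decrease the conditional entropy of linear observables. -/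
lemma bitEnt_le_conv [Fintype S] [Fintype β] [AddGroup S] [AddGroup β] {P Q : S → ℝ}
    (hP : ∀ s, 0 ≤ P s)
    (hQ : ∀ s, 0 ≤ Q s) (hQ1 : ∑ s, Q s = 1) (U : S → ZMod 2) (V : S → β)
    (hU : ∀ s t, U (s - t) = U s - U t) (hV : ∀ s t, V (s - t) = V s - V t) :
    bitEnt P U V ≤ bitEnt (fun x => ∑ z, Q z * P (x - z)) U V := by
  have hm : ∀ u b, mass (slice (fun x => ∑ z, Q z * P (x - z)) U u) V b
      = ∑ z, Q z * mass (slice P U (u - U z)) V (b - V z) := by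
    intro u b
    have hz : ∀ z, mass (slice P U (u - U z)) V (b - V z)
        = ∑ x, if V x = b then (if U x = u then P (x - z) else 0) else 0 := by
      intro z
      rw [mass_eq_sum_ite, ← Equiv.sum_comp (Equiv.subRight z)]
      simp only [Equiv.subRight_apply, slice, hU, hV, sub_left_inj]
    simp only [hz, Finset.mul_sum]
    rw [Finset.sum_comm, mass_eq_sum_ite]
    refine Finset.sum_congr rfl fun x _ => ?_
    by_cases h1 : V x = b <;> by_cases h2 : U x = u <;> simp [slice, h1, h2]
  have hs : ∀ z b, splitEnt (mass (slice P U (0 - U z)) V b) (mass (slice P U (1 - U z)) V b)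
      = splitEnt (mass (slice P U 0) V b) (mass (slice P U 1) V b) := by
    intro z b
    rcases zmod_two_cases (U z) with h | h
    · rw [h, sub_zero, sub_zero]
    · rw [h, sub_self, splitEnt_comm]; rfl
  calc bitEnt P U V = ∑ z, Q z * bitEnt P U V := by rw [← Finset.sum_mul, hQ1, one_mul]
    _ = ∑ z, ∑ b, splitEnt (Q z * mass (slice P U (0 - U z)) V (b - V z))
          (Q z * mass (slice P U (1 - U z)) V (b - V z)) := by
        refine Finset.sum_congr rfl fun z _ => ?_
        simp only [splitEnt_mul, hs, ← Finset.mul_sum]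
        congr 1
        exact (Equiv.sum_comp (Equiv.subRight (V z)) (fun b =>
          splitEnt (mass (slice P U 0) V b) (mass (slice P U 1) V b))).symm
    _ = ∑ b, ∑ z, splitEnt (Q z * mass (slice P U (0 - U z)) V (b - V z))
          (Q z * mass (slice P U (1 - U z)) V (b - V z)) := Finset.sum_comm
    _ ≤ bitEnt (fun x => ∑ z, Q z * P (x - z)) U V := by
        refine Finset.sum_le_sum fun b _ => ?_
        rw [hm, hm]
        exact sum_splitEnt_le _ _ _
          (fun z _ => mul_nonneg (hQ z) (mass_nonneg (slice_nonneg hP U _) V _))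
          (fun z _ => mul_nonneg (hQ z) (mass_nonneg (slice_nonneg hP U _) V _))

/-- Transport of the bias along an equivalence of sample spaces. -/
lemma bitBias_comp_equiv [Fintype S] [Fintype S'] [Fintype β] (e : S ≃ S') (P : S' → ℝ)
    (U : S' → ZMod 2) (V : S' → β) :
    bitBias (P ∘ e) (U ∘ e) (V ∘ e) = bitBias P U V := by
  unfold bitBias
  refine Finset.sum_congr rfl fun b _ => ?_
  have : ∀ u, mass (slice (P ∘ e) (U ∘ e) u) (V ∘ e) b = mass (slice P U u) V b := by
    intro u
    rw [mass_eq_sum_ite, mass_eq_sum_ite, ← Equiv.sum_comp e]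
    rfl
  rw [this, this]

lemma mass_slice_add_prod [Fintype S] (P : S → ℝ) (U : S → ZMod 2) (V : S → β) (u : ZMod 2)
    (b b' : β) :
    mass (slice (fun s : S × S => P s.1 * P s.2) (fun s => U s.1 + U s.2) u)
      (fun s => (V s.1, V s.2)) (b, b')
      = mass (slice P U u) V b * mass (slice P U 0) V b'
        + mass (slice P U (u + 1)) V b * mass (slice P U 1) V b' := by
  simp only [mass_eq_sum_ite, Fintype.sum_prod_type, Finset.sum_mul_sum, ← Finset.sum_add_distrib]
  refine Finset.sum_congr rfl fun s _ => Finset.sum_congr rfl fun t _ => ?_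
  simp only [slice, Prod.mk.injEq]
  by_cases h1 : V s = b <;> by_cases h2 : V t = b' <;> simp only [h1, h2] <;> simp
  rcases zmod_two_cases (U s) with h | h <;> rcases zmod_two_cases (U t) with h' | h' <;>
    rcases zmod_two_cases u with hu | hu <;> rw [h, h', hu] <;> simp [CharTwo.add_self_eq_zero]

lemma mass_slice_snd_prod [Fintype S] (P : S → ℝ) (U : S → ZMod 2) (V : S → β) (u v : ZMod 2)
    (b b' : β) :
    mass (slice (fun s : S × S => P s.1 * P s.2) (fun s => U s.2) u)
      (fun s => ((V s.1, V s.2), U s.1 + U s.2)) ((b, b'), v)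
      = mass (slice P U (v + u)) V b * mass (slice P U u) V b' := by
  simp only [mass_eq_sum_ite, Fintype.sum_prod_type, Finset.sum_mul_sum]
  refine Finset.sum_congr rfl fun s _ => Finset.sum_congr rfl fun t _ => ?_
  simp only [slice, Prod.mk.injEq]
  by_cases h1 : V s = b <;> by_cases h2 : V t = b' <;> simp only [h1, h2] <;> simp
  rcases zmod_two_cases (U s) with h | h <;> rcases zmod_two_cases (U t) with h' | h' <;>
    rcases zmod_two_cases u with hu | hu <;> rcases zmod_two_cases v with hv | hv <;>
    rw [h, h', hu, hv] <;> simp [CharTwo.add_self_eq_zero]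

lemma bitBias_add_prod [Fintype S] [Fintype β] (P : S → ℝ) (U : S → ZMod 2) (V : S → β) :
    bitBias (fun s : S × S => P s.1 * P s.2) (fun s => U s.1 + U s.2) (fun s => (V s.1, V s.2))
      = bitBias P U V ^ 2 := by
  unfold bitBias
  rw [sq, Finset.sum_mul_sum, Fintype.sum_prod_type]
  refine Finset.sum_congr rfl fun b _ => Finset.sum_congr rfl fun b' _ => ?_
  rw [mass_slice_add_prod, mass_slice_add_prod, ← abs_mul, show (1 + 1 : ZMod 2) = 0 from rfl,
    zero_add]
  congr 1; ring

lemma abs_split_le {a a' b b' : ℝ} (ha : 0 ≤ a) (ha' : 0 ≤ a') (hb : 0 ≤ b) (hb' : 0 ≤ b') :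
    |a * b - a' * b'| + |a' * b - a * b'|
      ≤ |a - a'| * (b + b') + (a + a') * |b - b'| - |a - a'| * |b - b'| := by
  have h1 := abs_sub_le_add_of_nonneg ha ha'
  have h2 := abs_sub_le_add_of_nonneg hb hb'
  have hx := abs_nonneg (a - a')
  have hy := abs_nonneg (b - b')
  rcases le_total a a' with h | h <;> rcases le_total b b' with h' | h' <;>
    rcases abs_cases (a * b - a' * b') with ⟨e1, _⟩ | ⟨e1, _⟩ <;>
    rcases abs_cases (a' * b - a * b') with ⟨e2, _⟩ | ⟨e2, _⟩ <;>
    first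
    | rw [e1, e2, abs_of_nonneg (sub_nonneg.2 h), abs_of_nonneg (sub_nonneg.2 h')]
      nlinarith [mul_nonneg ha hb, mul_nonneg ha hb', mul_nonneg ha' hb, mul_nonneg ha' hb']
    | rw [e1, e2, abs_of_nonneg (sub_nonneg.2 h), abs_of_nonpos (sub_nonpos.2 h')]
      nlinarith [mul_nonneg ha hb, mul_nonneg ha hb', mul_nonneg ha' hb, mul_nonneg ha' hb']
    | rw [e1, e2, abs_of_nonpos (sub_nonpos.2 h), abs_of_nonneg (sub_nonneg.2 h')]
      nlinarith [mul_nonneg ha hb, mul_nonneg ha hb', mul_nonneg ha' hb, mul_nonneg ha' hb']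
    | rw [e1, e2, abs_of_nonpos (sub_nonpos.2 h), abs_of_nonpos (sub_nonpos.2 h')]
      nlinarith [mul_nonneg ha hb, mul_nonneg ha hb', mul_nonneg ha' hb, mul_nonneg ha' hb']

lemma bitBias_snd_prod_le [Fintype S] [Fintype β] {P : S → ℝ} (hP : ∀ s, 0 ≤ P s)
    (hP1 : ∑ s, P s = 1) (U : S → ZMod 2)
    (V : S → β) :
    bitBias (fun s : S × S => P s.1 * P s.2) (fun s => U s.2)
        (fun s => ((V s.1, V s.2), U s.1 + U s.2))
      ≤ 2 * bitBias P U V - bitBias P U V ^ 2 := by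
  have hsum := sum_mass_slice_add P U V
  rw [hP1] at hsum
  have hR : 2 * bitBias P U V - bitBias P U V ^ 2
      = ∑ b, ∑ b', (|mass (slice P U 0) V b - mass (slice P U 1) V b|
            * (mass (slice P U 0) V b' + mass (slice P U 1) V b')
          + (mass (slice P U 0) V b + mass (slice P U 1) V b)
            * |mass (slice P U 0) V b' - mass (slice P U 1) V b'|
          - |mass (slice P U 0) V b - mass (slice P U 1) V b|
            * |mass (slice P U 0) V b' - mass (slice P U 1) V b'|) := by
    simp only [Finset.sum_sub_distrib, Finset.sum_add_distrib, ← Finset.sum_mul_sum]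
    simp only [← Finset.sum_add_distrib]
    rw [hsum]
    unfold bitBias; ring
  rw [hR]
  unfold bitBias
  rw [Fintype.sum_prod_type, Fintype.sum_prod_type]
  refine Finset.sum_le_sum fun b _ => Finset.sum_le_sum fun b' _ => ?_
  rw [sum_zmod_two]
  simp only [mass_slice_snd_prod]
  rw [show (1 + 1 : ZMod 2) = 0 from rfl, zero_add, zero_add, add_zero]
  exact abs_split_le (mass_nonneg (slice_nonneg hP U 0) V b)
    (mass_nonneg (slice_nonneg hP U 1) V b) (mass_nonneg (slice_nonneg hP U 0) V b')
    (mass_nonneg (slice_nonneg hP U 1) V b')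

end FiniteInformation

section PolarTransform

/-- Probability of the outcome `a` under Bernoulli(`p`). -/
noncomputable def bitWt (p : ℝ) (a : ZMod 2) : ℝ := if a = 0 then 1 - p else p

/-- Probability of the word `x` under i.i.d. Bernoulli(`p`). -/
noncomputable def prodWt (p : ℝ) (n : ℕ) (x : Fin n → ZMod 2) : ℝ := ∏ i, bitWt p (x i)

lemma bitWt_nonneg {p : ℝ} (hp0 : 0 ≤ p) (hp1 : p ≤ 1) (a : ZMod 2) : 0 ≤ bitWt p a := by
  unfold bitWt; split_ifs <;> linarith

lemma prodWt_nonneg {p : ℝ} (hp0 : 0 ≤ p) (hp1 : p ≤ 1) (n : ℕ) (x : Fin n → ZMod 2) :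
    0 ≤ prodWt p n x := Finset.prod_nonneg fun _ _ => bitWt_nonneg hp0 hp1 _

lemma sum_bitWt (p : ℝ) : ∑ a, bitWt p a = 1 := by
  rw [sum_zmod_two]; simp [bitWt]

lemma sum_prodWt (p : ℝ) (n : ℕ) : ∑ x, prodWt p n x = 1 := by
  unfold prodWt
  rw [← Fintype.prod_sum (fun (_ : Fin n) a => bitWt p a)]
  simp [sum_bitWt]

/-- The `j`-th output bit of the polar transform of length `2 ^ k`. -/
def polarBit (k j : ℕ) (x : Fin (2 ^ k) → ZMod 2) : ZMod 2 :=
  ∑ i, if j &&& i.val = j then x i else 0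

/-- The output bits of the polar transform with index in `A`. -/
def polarPart (k : ℕ) (A : Finset ℕ) (x : Fin (2 ^ k) → ZMod 2) (i : A) : ZMod 2 :=
  polarBit k i x

lemma vecMul_G (k : ℕ) (x : Fin (2 ^ k) → ZMod 2) (j : Fin (2 ^ k)) :
    Matrix.vecMul x (G k) j = polarBit k j x := by
  simp [Matrix.vecMul, dotProduct, G, polarBit]

lemma polarBit_sub (k j : ℕ) (x y : Fin (2 ^ k) → ZMod 2) :
    polarBit k j (x - y) = polarBit k j x - polarBit k j y := by
  unfold polarBit
  rw [← Finset.sum_sub_distrib]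
  refine Finset.sum_congr rfl fun i _ => ?_
  split_ifs <;> simp

lemma polarPart_eq_iff {k : ℕ} {A : Finset ℕ} {x y : Fin (2 ^ k) → ZMod 2} :
    polarPart k A x = polarPart k A y ↔ ∀ i ∈ A, polarBit k i x = polarBit k i y := by
  simp [funext_iff, polarPart]

/-- Positions of length `2 ^ (k + 1)` as pairs of a position of length `2 ^ k` and a last bit. -/
def childEquiv (k : ℕ) : Fin (2 ^ k) × Fin 2 ≃ Fin (2 ^ (k + 1)) :=
  finProdFinEquiv.trans (finCongr (pow_succ 2 k).symm)

lemma childEquiv_val (k : ℕ) (i : Fin (2 ^ k)) (b : Fin 2) :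
    (childEquiv k (i, b)).val = b + 2 * i := by
  simp [childEquiv]

/-- Deinterleaving a word into its entries at even and at odd positions. -/
def splitEquiv (k : ℕ) : (Fin (2 ^ (k + 1)) → ZMod 2) ≃
    (Fin (2 ^ k) → ZMod 2) × (Fin (2 ^ k) → ZMod 2) :=
  (((childEquiv k).arrowCongr (Equiv.refl (ZMod 2))).symm.trans
    (Equiv.curry _ _ _)).trans
  { toFun := fun f => (fun i => f i 0, fun i => f i 1)
    invFun := fun s i b => if b = 0 then s.1 i else s.2 i
    left_inv := fun f => by
      funext i b
      fin_cases b <;> simp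
    right_inv := fun s => by simp }

lemma splitEquiv_fst (k : ℕ) (x : Fin (2 ^ (k + 1)) → ZMod 2) (i : Fin (2 ^ k)) :
    (splitEquiv k x).1 i = x (childEquiv k (i, 0)) := rfl

lemma splitEquiv_snd (k : ℕ) (x : Fin (2 ^ (k + 1)) → ZMod 2) (i : Fin (2 ^ k)) :
    (splitEquiv k x).2 i = x (childEquiv k (i, 1)) := rfl

lemma prodWt_split (p : ℝ) (k : ℕ) (x : Fin (2 ^ (k + 1)) → ZMod 2) :
    prodWt p (2 ^ (k + 1)) x
      = prodWt p (2 ^ k) (splitEquiv k x).1 * prodWt p (2 ^ k) (splitEquiv k x).2 := by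
  simp only [prodWt, splitEquiv_fst, splitEquiv_snd]
  rw [← Equiv.prod_comp (childEquiv k), Fintype.prod_prod_type, ← Finset.prod_mul_distrib]
  simp only [Fin.prod_univ_two]

lemma land_children (j i a b : ℕ) (ha : a < 2) (hb : b < 2) :
    (a + 2 * j) &&& (b + 2 * i) = a + 2 * j ↔ (j &&& i = j ∧ a ≤ b) := by
  have h1 := Nat.and_div_two (a := a + 2 * j) (b := b + 2 * i)
  have h2 := Nat.and_mod_two_pow (a := a + 2 * j) (b := b + 2 * i) (n := 1)
  rw [show (a + 2 * j) / 2 = j by omega, show (b + 2 * i) / 2 = i by omega] at h1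
  rw [pow_one, show (a + 2 * j) % 2 = a by omega, show (b + 2 * i) % 2 = b by omega] at h2
  have h3 : a &&& b = a ↔ a ≤ b := by
    interval_cases a <;> interval_cases b <;> simp
  have h4 : a &&& b < 2 := lt_of_le_of_lt Nat.and_le_left ha
  rw [← h3]
  constructor
  · intro h; rw [h] at h1 h2; omega
  · rintro ⟨h, h'⟩; omega

lemma polarBit_two_mul (k j : ℕ) (x : Fin (2 ^ (k + 1)) → ZMod 2) :
    polarBit (k + 1) (2 * j) x
      = polarBit k j (splitEquiv k x).1 + polarBit k j (splitEquiv k x).2 := by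
  simp only [polarBit, splitEquiv_fst, splitEquiv_snd]
  rw [← Equiv.sum_comp (childEquiv k), Fintype.sum_prod_type, ← Finset.sum_add_distrib]
  refine Finset.sum_congr rfl fun i _ => ?_
  have h0 := land_children j i 0 0 (by norm_num) (by norm_num)
  have h1 := land_children j i 0 1 (by norm_num) (by norm_num)
  simp only [zero_add, le_refl, zero_le, and_true] at h0 h1
  simp [Fin.sum_univ_two, childEquiv_val, h0, h1]

lemma polarBit_two_mul_add_one (k j : ℕ) (x : Fin (2 ^ (k + 1)) → ZMod 2) :
    polarBit (k + 1) (2 * j + 1) x = polarBit k j (splitEquiv k x).2 := by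
  simp only [polarBit, splitEquiv_snd]
  rw [← Equiv.sum_comp (childEquiv k), Fintype.sum_prod_type]
  refine Finset.sum_congr rfl fun i _ => ?_
  have h0 := land_children j i 1 0 (by norm_num) (by norm_num)
  have h1 := land_children j i 1 1 (by norm_num) (by norm_num)
  simp only [zero_add, le_refl, and_true, add_comm 1 (2 * j)] at h0 h1
  simp [Fin.sum_univ_two, childEquiv_val, h0, h1]

lemma polarPart_range_two_mul {k j : ℕ} {x y : Fin (2 ^ (k + 1)) → ZMod 2} :
    polarPart (k + 1) (Finset.range (2 * j)) x = polarPart (k + 1) (Finset.range (2 * j)) y ↔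
      polarPart k (Finset.range j) (splitEquiv k x).1
          = polarPart k (Finset.range j) (splitEquiv k y).1 ∧
        polarPart k (Finset.range j) (splitEquiv k x).2
          = polarPart k (Finset.range j) (splitEquiv k y).2 := by
  simp only [polarPart_eq_iff, Finset.mem_range]
  constructor
  · intro h
    have h2 : ∀ i < j, polarBit k i (splitEquiv k x).2 = polarBit k i (splitEquiv k y).2 := by
      intro i hi
      rw [← polarBit_two_mul_add_one, ← polarBit_two_mul_add_one]
      exact h _ (by omega)
    refine ⟨fun i hi => ?_, h2⟩
    have := h (2 * i) (by omega)
    rwa [polarBit_two_mul, polarBit_two_mul, h2 i hi, add_left_inj] at this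
  · rintro ⟨h1, h2⟩ i hi
    obtain ⟨m, rfl | rfl⟩ := Nat.even_or_odd' i
    · rw [polarBit_two_mul, polarBit_two_mul, h1 m (by omega), h2 m (by omega)]
    · rw [polarBit_two_mul_add_one, polarBit_two_mul_add_one, h2 m (by omega)]

lemma polarPart_range_succ {k j : ℕ} {x y : Fin (2 ^ k) → ZMod 2} :
    polarPart k (Finset.range (j + 1)) x = polarPart k (Finset.range (j + 1)) y ↔
      polarPart k (Finset.range j) x = polarPart k (Finset.range j) y ∧
        polarBit k j x = polarBit k j y := by
  simp only [polarPart_eq_iff, Finset.range_add_one, Finset.forall_mem_insert, and_comm]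

lemma polarPart_range_injective (k : ℕ) :
    Function.Injective (polarPart k (Finset.range (2 ^ k))) := by
  induction k with
  | zero =>
    intro x y h
    have := polarPart_eq_iff.1 h 0 (by simp)
    simp only [polarBit, Nat.zero_and, if_true] at this
    funext i
    have hi : ∀ z : Fin (2 ^ 0) → ZMod 2, ∑ i, z i = z i := fun z =>
      Fintype.sum_eq_single i fun a ha => absurd (Subsingleton.elim (α := Fin 1) a i) ha
    rwa [hi, hi] at this
  | succ k ih =>
    intro x y h
    rw [pow_succ', polarPart_range_two_mul] at h
    exact (splitEquiv k).injective (Prod.ext (ih h.1) (ih h.2))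

/-- Bias of the `j`-th polar bit given the earlier ones. -/
noncomputable def polarBias (p : ℝ) (k j : ℕ) : ℝ :=
  bitBias (prodWt p (2 ^ k)) (polarBit k j) (polarPart k (Finset.range j))

/-- Conditional entropy in nats of the `j`-th polar bit given the earlier ones. -/
noncomputable def polarEnt (p : ℝ) (k j : ℕ) : ℝ :=
  bitEnt (prodWt p (2 ^ k)) (polarBit k j) (polarPart k (Finset.range j))

lemma prodWt_succ (p : ℝ) (k : ℕ) : prodWt p (2 ^ (k + 1))
    = (fun s => prodWt p (2 ^ k) s.1 * prodWt p (2 ^ k) s.2) ∘ splitEquiv k :=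
  funext (prodWt_split p k)

lemma polarBias_two_mul (p : ℝ) (k j : ℕ) :
    polarBias p (k + 1) (2 * j) = polarBias p k j ^ 2 := by
  unfold polarBias
  rw [← bitBias_add_prod, ← bitBias_comp_equiv (splitEquiv k), ← prodWt_succ,
    show polarBit (k + 1) (2 * j) = _ from funext (polarBit_two_mul k j)]
  refine bitBias_congr _ _ fun x y => ?_
  simp only [polarPart_range_two_mul, Function.comp_apply, Prod.mk.injEq]

lemma polarBias_two_mul_add_one_le {p : ℝ} (hp0 : 0 ≤ p) (hp1 : p ≤ 1) (k j : ℕ) :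
    polarBias p (k + 1) (2 * j + 1) ≤ 2 * polarBias p k j - polarBias p k j ^ 2 := by
  refine le_trans (le_of_eq ?_) (bitBias_snd_prod_le (prodWt_nonneg hp0 hp1 _) (sum_prodWt p _)
    (polarBit k j) (polarPart k (Finset.range j)))
  unfold polarBias
  rw [← bitBias_comp_equiv (splitEquiv k), ← prodWt_succ,
    show polarBit (k + 1) (2 * j + 1) = _ from funext (polarBit_two_mul_add_one k j)]
  refine bitBias_congr _ _ fun x y => ?_
  simp only [polarPart_range_succ, polarPart_range_two_mul, Function.comp_apply, Prod.mk.injEq,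
    polarBit_two_mul]

lemma squareDoubleTree_polarBias {p : ℝ} (hp0 : 0 ≤ p) (hp1 : p ≤ 1) :
    SquareDoubleTree (polarBias p) where
  nonneg _ _ := bitBias_nonneg _ _ _
  le_one _ _ := bitBias_le_one (prodWt_nonneg hp0 hp1 _) (sum_prodWt p _) _ _
  left_le k j := (polarBias_two_mul p k j).le
  right_le := polarBias_two_mul_add_one_le hp0 hp1

lemma ent_polarPart_insert (k j : ℕ) (P : (Fin (2 ^ k) → ZMod 2) → ℝ) (A : Finset ℕ) :
    ent P (polarPart k (insert j A))
      = ent P (polarPart k A) + bitEnt P (polarBit k j) (polarPart k A) :=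
  ent_adjoin _ _ _ fun x y => by
    simp only [polarPart_eq_iff, Finset.forall_mem_insert, and_comm]

lemma ent_polarPart_empty (k : ℕ) {P : (Fin (2 ^ k) → ZMod 2) → ℝ} (hP1 : ∑ s, P s = 1) :
    ent P (polarPart k ∅) = 0 := by
  have h : ∀ b, mass P (polarPart k ∅) b = 1 := fun b => by
    rw [mass_eq_sum_ite, ← hP1]
    exact Finset.sum_congr rfl fun s _ => if_pos (Subsingleton.elim _ _)
  simp [ent, h]

/-- Chain rule, with some conditioning variables dropped. -/
lemma sum_polarEnt_le {p : ℝ} (hp0 : 0 ≤ p) (hp1 : p ≤ 1) (k : ℕ) (A : Finset ℕ) :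
    ∑ j ∈ A, polarEnt p k j ≤ ent (prodWt p (2 ^ k)) (polarPart k A) := by
  induction A using Finset.induction_on_max with
  | empty => rw [ent_polarPart_empty k (sum_prodWt p _), Finset.sum_empty]
  | insert j A hA ih =>
    have hj : j ∉ A := fun h => lt_irrefl _ (hA j h)
    rw [Finset.sum_insert hj, ent_polarPart_insert, add_comm]
    refine add_le_add ih (bitEnt_le_of_coarser (prodWt_nonneg hp0 hp1 _) _
      (fun (b : Finset.range j → ZMod 2) (i : A) => b ⟨i, Finset.mem_range.2 (hA i i.2)⟩)
      fun _ => rfl)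

lemma sum_range_polarEnt (p : ℝ) (k m : ℕ) :
    ∑ j ∈ Finset.range m, polarEnt p k j
      = ent (prodWt p (2 ^ k)) (polarPart k (Finset.range m)) := by
  induction m with
  | zero => rw [Finset.range_zero, ent_polarPart_empty k (sum_prodWt p _), Finset.sum_empty]
  | succ m ih =>
    rw [Finset.sum_range_succ, ih, Finset.range_add_one, ent_polarPart_insert]; rfl

lemma mass_id {S : Type*} [Fintype S] (P : S → ℝ) (s : S) : mass P id s = P s := by
  simp [mass_eq_sum_ite]

lemma sum_negMulLog_prodWt (p : ℝ) (k : ℕ) :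
    ∑ x, Real.negMulLog (prodWt p (2 ^ k) x)
      = 2 ^ k * (Real.negMulLog p + Real.negMulLog (1 - p)) := by
  induction k with
  | zero =>
    have h : ∀ x : Fin (2 ^ 0) → ZMod 2, prodWt p (2 ^ 0) x = bitWt p (x 0) := fun x =>
      Fintype.prod_eq_single 0 fun a ha => absurd (Subsingleton.elim (α := Fin 1) a 0) ha
    simp only [h]
    rw [show ∑ x : Fin (2 ^ 0) → ZMod 2, Real.negMulLog (bitWt p (x 0))
      = ∑ a, Real.negMulLog (bitWt p a) from
        Equiv.sum_comp (Equiv.funUnique (Fin 1) (ZMod 2)) fun a => Real.negMulLog (bitWt p a),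
      sum_zmod_two]
    simp [bitWt, add_comm]
  | succ k ih =>
    rw [prodWt_succ]
    simp only [Function.comp_apply]
    rw [Equiv.sum_comp (splitEquiv k) fun s =>
      Real.negMulLog (prodWt p (2 ^ k) s.1 * prodWt p (2 ^ k) s.2), Fintype.sum_prod_type]
    simp only [Real.negMulLog_mul, Finset.sum_add_distrib, ← Finset.mul_sum, ← Finset.sum_mul,
      sum_prodWt, ih]
    ring

lemma levelAvg_polarEnt (p : ℝ) (k : ℕ) :
    levelAvg k (fun j => polarEnt p k j / Real.log 2) = binEnt p := by
  unfold levelAvg binEnt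
  rw [← Finset.sum_div, sum_range_polarEnt,
    ent_congr (V := polarPart k _) (W := id) _ fun x y => (polarPart_range_injective k).eq_iff]
  simp only [ent, mass_id, sum_negMulLog_prodWt]
  field_simp

/-- Polarization: the fraction of nearly uniform polar bits tends to the source entropy. -/
lemma tendsto_levelAvg_polarEnt {p : ℝ} (hp0 : 0 ≤ p) (hp1 : p ≤ 1) {ε : ℝ} (hε0 : 0 < ε)
    (hε1 : ε < 1) :
    Tendsto (fun k => levelAvg k
      (fun j => if 1 - ε ^ 2 / (2 * 2 ^ k) ≤ polarEnt p k j / Real.log 2 then 1 else 0))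
      atTop (nhds (binEnt p)) := by
  have hlog : 0 < Real.log 2 := Real.log_pos one_lt_two
  refine (squareDoubleTree_polarBias hp0 hp1).tendsto_levelAvg (fun k j => ?_) (fun k j => ?_)
    (fun k j l hl => ?_) (levelAvg_polarEnt p) hε0 hε1
  · rw [div_le_one hlog]
    exact bitEnt_le_log_two (prodWt_nonneg hp0 hp1 _) (sum_prodWt p _) _ _
  · rw [le_div_iff₀ hlog]
    exact bitEnt_lower (prodWt_nonneg hp0 hp1 _) (sum_prodWt p _) _ _
  · rw [div_le_iff₀ hlog]
    refine (bitEnt_upper (prodWt_nonneg hp0 hp1 _) (sum_prodWt p _) _ _ hl).trans ?_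
    change l + (1 - polarBias p k j) / (2 * l) ≤ _
    have hb : 0 ≤ 1 - polarBias p k j :=
      sub_nonneg.2 (bitBias_le_one (prodWt_nonneg hp0 hp1 _) (sum_prodWt p _) _ _)
    have hnn : 0 ≤ 2 * l + (1 - polarBias p k j) / l := by positivity
    have hhalf : 1 / 2 ≤ Real.log 2 := by linarith [Real.log_two_gt_d9]
    calc l + (1 - polarBias p k j) / (2 * l) = (2 * l + (1 - polarBias p k j) / l) * (1 / 2) := by
          field_simp
      _ ≤ _ := mul_le_mul_of_nonneg_left hhalf hnn

end PolarTransform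

section UniformComparison

lemma sq_sub_one_le_mul_kl {t : ℝ} (ht : 0 ≤ t) :
    |t - 1| ^ 2 ≤ (2 + (|t - 1| + (t - 1)) / 2) * (1 - t - Real.negMulLog t) := by
  rw [sq_abs, Real.negMulLog]
  rcases le_total 1 t with h | h
  · rw [abs_of_nonneg (by linarith)]
    have hlog := Real.le_log_one_add_of_nonneg (sub_nonneg.2 h)
    rw [show 1 + (t - 1) = t by ring, div_le_iff₀ (by linarith)] at hlog
    nlinarith [mul_le_mul_of_nonneg_left hlog ht]
  · rw [abs_of_nonpos (by linarith)]
    rcases ht.eq_or_lt with rfl | ht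
    · norm_num
    · have hs : 0 ≤ Real.log t⁻¹ := Real.log_nonneg ((one_le_inv₀ ht).2 h)
      have := Real.self_le_sinh_iff.2 hs
      rw [Real.sinh_log (inv_pos.2 ht), inv_inv, Real.log_inv] at this
      have h3 := mul_le_mul_of_nonneg_left this ht.le
      have h4 : t * ((t⁻¹ - t) / 2) = (1 - t ^ 2) / 2 := by field_simp
      rw [h4] at h3
      nlinarith

/-- A Pinsker-type inequality against the uniform distribution. -/
lemma l1_sq_le_of_entropy {β : Type*} [Fintype β] {m : β → ℝ} (hm : ∀ b, 0 ≤ m b)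
    (hm1 : ∑ b, m b = 1) :
    (∑ b, |m b - 1 / Fintype.card β|) ^ 2 ≤ (2 + (∑ b, |m b - 1 / Fintype.card β|) / 2) *
      (Real.log (Fintype.card β) - ∑ b, Real.negMulLog (m b)) := by
  obtain ⟨N, hN⟩ : ∃ N : ℝ, N = Fintype.card β := ⟨_, rfl⟩
  rw [← hN]
  have hNpos : 0 < N := by
    rcases isEmpty_or_nonempty β with h | h
    · simp at hm1
    · rw [hN]; exact Nat.cast_pos.2 Fintype.card_pos
  set L := ∑ b, |m b - 1 / N| with hL
  have habs : ∑ b, |N * m b - 1| = N * L := by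
    rw [hL, Finset.mul_sum]
    refine Finset.sum_congr rfl fun b _ => ?_
    rw [← abs_of_pos hNpos, ← abs_mul, abs_of_pos hNpos]
    congr 1; field_simp
  have hlin : ∑ b, (N * m b - 1) = 0 := by
    rw [Finset.sum_sub_distrib, ← Finset.mul_sum, hm1]; simp [hN]
  have hcs := Finset.sum_sq_le_sum_mul_sum_of_sq_le_mul Finset.univ
    (r := fun b => |N * m b - 1|)
    (f := fun b => 2 + (|N * m b - 1| + (N * m b - 1)) / 2)
    (g := fun b => 1 - N * m b - Real.negMulLog (N * m b))
    (fun b _ => by linarith [neg_abs_le (N * m b - 1)])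
    (fun b _ => by
      have h1 : (0:ℝ) < 2 + (|N * m b - 1| + (N * m b - 1)) / 2 := by
        linarith [neg_abs_le (N * m b - 1)]
      exact nonneg_of_mul_nonneg_right
        ((sq_nonneg _).trans (sq_sub_one_le_mul_kl (mul_nonneg hNpos.le (hm b)))) h1)
    (fun b _ => sq_sub_one_le_mul_kl (mul_nonneg hNpos.le (hm b)))
  have hf : ∑ b, (2 + (|N * m b - 1| + (N * m b - 1)) / 2) = N * (2 + L / 2) := by
    rw [Finset.sum_add_distrib, ← Finset.sum_div, Finset.sum_add_distrib, habs, hlin]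
    simp [← hN]; ring
  have hg : ∑ b, (1 - N * m b - Real.negMulLog (N * m b))
      = N * (Real.log N - ∑ b, Real.negMulLog (m b)) := by
    rw [Finset.sum_sub_distrib]
    simp only [Real.negMulLog_mul, Finset.sum_add_distrib, ← Finset.mul_sum, ← Finset.sum_mul, hm1]
    have h1 : ∑ b, (1 - N * m b) = 0 := by
      rw [← neg_eq_zero, ← Finset.sum_neg_distrib, ← hlin]
      exact Finset.sum_congr rfl fun b _ => by ring
    rw [h1, Real.negMulLog]; ring
  rw [habs, hf, hg] at hcs
  have hN2 : 0 < N ^ 2 := by positivity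
  refine le_of_mul_le_mul_left ?_ hN2
  calc N ^ 2 * L ^ 2 = (N * L) ^ 2 := by ring
    _ ≤ _ := hcs
    _ = _ := by ring

lemma l1_le_of_entropy {β : Type*} [Fintype β] {m : β → ℝ} (hm : ∀ b, 0 ≤ m b)
    (hm1 : ∑ b, m b = 1) {ε : ℝ} (hε0 : 0 < ε) (hε1 : ε < 1)
    (hent : Real.log (Fintype.card β) - ε ^ 2 / 2 * Real.log 2 ≤ ∑ b, Real.negMulLog (m b)) :
    ∑ b, |m b - 1 / Fintype.card β| ≤ ε := by
  have h := l1_sq_le_of_entropy hm hm1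
  have hL0 : 0 ≤ ∑ b, |m b - 1 / (Fintype.card β : ℝ)| := Finset.sum_nonneg fun _ _ => abs_nonneg _
  generalize ∑ b, |m b - 1 / (Fintype.card β : ℝ)| = L at h hL0
  by_contra! hlt
  have hc : Real.log (Fintype.card β) - ∑ b, Real.negMulLog (m b) ≤ ε ^ 2 * (7 / 20) := by
    nlinarith [Real.log_two_lt_d9, sq_nonneg ε]
  have h1 : L ^ 2 ≤ (2 + L / 2) * (ε ^ 2 * (7 / 20)) :=
    h.trans (mul_le_mul_of_nonneg_left hc (by positivity))
  have h2 : ε ^ 2 < L ^ 2 := by gcongr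
  have h3 : L * ε ^ 2 ≤ L ^ 2 := by
    rw [sq L]
    exact mul_le_mul_of_nonneg_left (by nlinarith) hL0
  nlinarith

end UniformComparison

section Degradation

lemma prodWt_eq_conv {p q r : ℝ} (h : ∀ a, bitWt p a = ∑ c, bitWt q c * bitWt r (a - c)) (n : ℕ) :
    prodWt p n = fun x => ∑ z, prodWt q n z * prodWt r n (x - z) := by
  funext x
  simp only [prodWt, h, ← Finset.prod_mul_distrib, Pi.sub_apply]
  exact Fintype.prod_sum fun i c => bitWt q c * bitWt r (x i - c)

/-- Adding independent noise increases the conditional entropy of every polar bit. -/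
lemma polarEnt_le_polarEnt {p r : ℝ} (hr0 : 0 ≤ r) (hr : r < 1 / 2) (h1 : r ≤ p) (h2 : p ≤ 1 - r)
    (k j : ℕ) : polarEnt r k j ≤ polarEnt p k j := by
  have hpos : 0 < 1 - 2 * r := by linarith
  set q := (p - r) / (1 - 2 * r) with hq
  have hq0 : 0 ≤ q := div_nonneg (by linarith) hpos.le
  have hq1 : q ≤ 1 := (div_le_one hpos).2 (by linarith)
  have hqr : q * (1 - 2 * r) = p - r := div_mul_cancel₀ _ hpos.ne'
  have hconv : ∀ a, bitWt p a = ∑ c, bitWt q c * bitWt r (a - c) := by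
    intro a
    rw [sum_zmod_two]
    rcases zmod_two_cases a with rfl | rfl <;> simp [bitWt] <;> linarith
  unfold polarEnt
  rw [prodWt_eq_conv hconv]
  exact bitEnt_le_conv (prodWt_nonneg hr0 (by linarith) _) (prodWt_nonneg hq0 hq1 _)
    (sum_prodWt q _) _ _ (polarBit_sub k j) fun x y => funext fun i => polarBit_sub k i x y

lemma binEnt_eq_binEntropy (p : ℝ) : binEnt p = Real.binEntropy p / Real.log 2 := by
  rw [binEnt, Real.binEntropy_eq_negMulLog_add_negMulLog_one_sub]

lemma lt_half_of_binEnt_lt_one {r : ℝ} (hr : r ≤ 1 / 2) (h : binEnt r < 1) : r < 1 / 2 := by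
  refine lt_of_le_of_ne hr ?_
  rintro rfl
  rw [binEnt_eq_binEntropy, one_div, Real.binEntropy_two_inv,
    div_self (Real.log_pos one_lt_two).ne'] at h
  exact lt_irrefl _ h

lemma le_of_binEnt_le {p r : ℝ} (hp0 : 0 ≤ p) (hr : r ≤ 1 / 2) (h : binEnt r ≤ binEnt p) :
    r ≤ p := by
  rw [binEnt_eq_binEntropy, binEnt_eq_binEntropy,
    div_le_div_iff_of_pos_right (Real.log_pos one_lt_two)] at h
  by_contra! hlt
  have h2 : r ≤ 2⁻¹ := by linarith
  exact absurd (Real.binEntropy_strictMonoOn ⟨hp0, hlt.le.trans h2⟩ ⟨hp0.trans hlt.le, h2⟩ hlt)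
    h.not_gt

lemma binEnt_one_sub (p : ℝ) : binEnt (1 - p) = binEnt p := by
  rw [binEnt_eq_binEntropy, Real.binEntropy_one_sub, binEnt_eq_binEntropy]

/-- Polar bits that are nearly uniform given the past are jointly nearly uniform. -/
lemma l1_polarPart_le {p r : ℝ} (hp0 : 0 ≤ p) (hp1 : p ≤ 1) (hr0 : 0 < r) (hr : r ≤ 1 / 2)
    (hr1 : binEnt r < 1) (h : binEnt r ≤ binEnt p) {ε : ℝ} (hε0 : 0 < ε) (hε1 : ε < 1) {k : ℕ}
    {A : Finset ℕ} (hA : A ⊆ Finset.range (2 ^ k))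
    (hAr : ∀ j ∈ A, 1 - ε ^ 2 / (2 * 2 ^ k) ≤ polarEnt r k j / Real.log 2) :
    ∑ v, |mass (prodWt p (2 ^ k)) (polarPart k A) v - 1 / 2 ^ A.card| ≤ ε := by
  have hlog : 0 < Real.log 2 := Real.log_pos one_lt_two
  have hcard : (Fintype.card (A → ZMod 2) : ℝ) = 2 ^ A.card := by simp
  rw [← hcard]
  refine l1_le_of_entropy (mass_nonneg (prodWt_nonneg hp0 hp1 _) _)
    (by rw [sum_mass, sum_prodWt]) hε0 hε1 (le_trans ?_ (sum_polarEnt_le hp0 hp1 k A))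
  have hle : ∀ j ∈ A, (1 - ε ^ 2 / (2 * 2 ^ k)) * Real.log 2 ≤ polarEnt p k j := fun j hj =>
    ((le_div_iff₀ hlog).1 (hAr j hj)).trans (polarEnt_le_polarEnt hr0.le
      (lt_half_of_binEnt_lt_one hr hr1) (le_of_binEnt_le hp0 hr h)
      (by linarith [le_of_binEnt_le (sub_nonneg.2 hp1) hr (by rwa [binEnt_one_sub])]) k j)
  refine le_trans ?_ (Finset.sum_le_sum hle)
  have hcardle : (A.card : ℝ) ≤ 2 ^ k := by
    exact_mod_cast (Finset.card_le_card hA).trans_eq (Finset.card_range _)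
  have hfrac : A.card * (ε ^ 2 / (2 * 2 ^ k)) ≤ ε ^ 2 / 2 := by
    calc A.card * (ε ^ 2 / (2 * 2 ^ k)) ≤ 2 ^ k * (ε ^ 2 / (2 * 2 ^ k)) := by gcongr
      _ = _ := by field_simp
  rw [hcard, Real.log_pow, Finset.sum_const, nsmul_eq_mul]
  nlinarith

end Degradation

section Source

variable {Ω : Type*} [MeasurableSpace Ω] {μ : Measure Ω} {p : ℝ}

lemma bern_singleton (p : ℝ) (a : ZMod 2) : bern p {a} = ENNReal.ofReal (bitWt p a) := by
  rcases zmod_two_cases a with rfl | rfl <;> simp [bern, bitWt]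

instance isFiniteMeasure_bern (p : ℝ) : IsFiniteMeasure (bern p) :=
  ⟨by simp [bern]⟩

lemma measure_preimage_eq_mass (hp0 : 0 ≤ p) (hp1 : p ≤ 1) {n : ℕ} {X : Ω → Fin n → ZMod 2}
    (hX : Measurable X) (hμ : μ.map X = Measure.pi fun _ => bern p) {β : Type*}
    (f : (Fin n → ZMod 2) → β) (b : β) :
    (μ ((fun ω => f (X ω)) ⁻¹' {b})).toReal = mass (prodWt p n) f b := by
  have hset : (fun ω => f (X ω)) ⁻¹' {b}
      = X ⁻¹' (Finset.univ.filter (fun x => f x = b) : Finset (Fin n → ZMod 2)) := by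
    ext ω; simp
  rw [hset, ← Measure.map_apply hX (Finset.measurableSet _), hμ, ← sum_measure_singleton,
    ENNReal.toReal_sum (fun x _ => measure_ne_top _ _), mass]
  refine Finset.sum_congr rfl fun x _ => ?_
  rw [Measure.pi_singleton, ENNReal.toReal_prod, prodWt]
  refine Finset.prod_congr rfl fun i _ => ?_
  rw [bern_singleton, ENNReal.toReal_ofReal (bitWt_nonneg hp0 hp1 _)]

lemma shEnt_eq_ent (hp0 : 0 ≤ p) (hp1 : p ≤ 1) {n : ℕ} {X : Ω → Fin n → ZMod 2}
    (hX : Measurable X) (hμ : μ.map X = Measure.pi fun _ => bern p) {β : Type*} [Fintype β]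
    (f : (Fin n → ZMod 2) → β) :
    shEnt μ (fun ω => f (X ω)) = ent (prodWt p n) f / Real.log 2 := by
  unfold shEnt ent
  simp only [measure_preimage_eq_mass hp0 hp1 hX hμ]

lemma cEnt_vecMul_G (hp0 : 0 ≤ p) (hp1 : p ≤ 1) {k : ℕ} {X : Ω → Fin (2 ^ k) → ZMod 2}
    (hX : Measurable X) (hμ : μ.map X = Measure.pi fun _ => bern p) (j : Fin (2 ^ k)) :
    cEnt μ (fun ω => Matrix.vecMul (X ω) (G k) j)
      (fun ω (i : Fin j.val) => Matrix.vecMul (X ω) (G k) (i.castLE j.isLt.le))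
      = polarEnt p k j / Real.log 2 := by
  have hpast : ∀ x y : Fin (2 ^ k) → ZMod 2,
      (fun i : Fin j.val => polarBit k i x) = (fun i : Fin j.val => polarBit k i y)
        ↔ polarPart k (Finset.range j) x = polarPart k (Finset.range j) y := fun x y => by
    rw [polarPart_eq_iff, funext_iff]
    simp [Fin.forall_iff]
  simp only [vecMul_G, Fin.val_castLE, cEnt]
  rw [shEnt_eq_ent hp0 hp1 hX hμ fun x => (polarBit k j x, fun i : Fin j.val => polarBit k i x),
    shEnt_eq_ent hp0 hp1 hX hμ fun x => fun i : Fin j.val => polarBit k i x,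
    ent_congr _ hpast, ent_adjoin _ (polarBit k j) (polarPart k (Finset.range j)), polarEnt]
  · ring
  · intro x y
    rw [Prod.mk.injEq, hpast, and_comm]

lemma image_val_highSet (hp0 : 0 ≤ p) (hp1 : p ≤ 1) {k : ℕ} {X : Ω → Fin (2 ^ k) → ZMod 2}
    (hX : Measurable X) (hμ : μ.map X = Measure.pi fun _ => bern p) (thr : ℝ) :
    (highSet μ k X thr).map Fin.valEmbedding
      = (Finset.range (2 ^ k)).filter fun j => thr ≤ polarEnt p k j / Real.log 2 := by
  ext j
  simp only [highSet, cEnt_vecMul_G hp0 hp1 hX hμ, Finset.mem_map, Finset.mem_filter,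
    Finset.mem_univ, true_and, Fin.valEmbedding_apply, Finset.mem_range]
  constructor
  · rintro ⟨i, hi, rfl⟩; exact ⟨i.isLt, hi⟩
  · rintro ⟨hj, h⟩; exact ⟨⟨j, hj⟩, h, rfl⟩

end Source

/-- the polar extractor `Pext`.
Let `n = 2^k`, `κ ∈ (0,1)`, `p(κ) ∈ (0,1/2]` with `h(p(κ)) = κ`, `ε ∈ (0,1)` and
`ε̃ = ε²/(2n)`. Let `R = R_{ε̃}(p(κ))` be the set of indices `j` with
`H(Y(p(κ))_j | Y(p(κ))^{j-1}) ≥ 1 - ε̃`, computed from a reference i.i.d.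
Bernoulli(p(κ)) source. Then (i) for any i.i.d. Bernoulli(p) source with `h(p) ≥ κ`,
the law of `(Y_j : j ∈ R)` is within `ε` of uniform in `ℓ¹` distance, and
(ii) `|R| / n → κ`. -/
theorem statement6 (κ : ℝ) (hκ0 : 0 < κ) (hκ1 : κ < 1)
    (pκ : ℝ) (hpκ0 : 0 < pκ) (hpκh : pκ ≤ 1 / 2) (hpκ : binEnt pκ = κ)
    (ε : ℝ) (hε0 : 0 < ε) (hε1 : ε < 1)
    (Ω0 : ℕ → Type) [∀ k, MeasurableSpace (Ω0 k)] (μ0 : ∀ k, Measure (Ω0 k))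
    (hprob0 : ∀ k, IsProbabilityMeasure (μ0 k))
    (X0 : ∀ k, Ω0 k → (Fin (2 ^ k) → ZMod 2))
    (hmeas0 : ∀ k, Measurable (X0 k))
    (hiid0 : ∀ k, (μ0 k).map (X0 k) = Measure.pi fun _ : Fin (2 ^ k) => bern pκ) :
    (∀ k : ℕ, ∀ p : ℝ, 0 ≤ p → p ≤ 1 → κ ≤ binEnt p →
      ∀ (Ω : Type) (_ : MeasurableSpace Ω) (μ : Measure Ω), IsProbabilityMeasure μ →
      ∀ X : Ω → (Fin (2 ^ k) → ZMod 2), Measurable X →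
        μ.map X = (Measure.pi fun _ : Fin (2 ^ k) => bern p) →
        ∑ v : ({j // j ∈ highSet (μ0 k) k (X0 k) (1 - ε ^ 2 / (2 * 2 ^ k))} → ZMod 2),
          abs ((μ {ω | ∀ j, Matrix.vecMul (X ω) (G k) j.val = v j}).toReal -
            1 / 2 ^ (highSet (μ0 k) k (X0 k) (1 - ε ^ 2 / (2 * 2 ^ k))).card) ≤ ε)
    ∧ Tendsto (fun k : ℕ =>
        (((highSet (μ0 k) k (X0 k) (1 - ε ^ 2 / (2 * 2 ^ k))).card : ℝ) / 2 ^ k))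
        atTop (nhds κ) := by
  have hpκ1 : pκ ≤ 1 := by linarith
  have hmap := fun k thr =>
    image_val_highSet hpκ0.le hpκ1 (hmeas0 k) (hiid0 k) thr
  constructor
  · intro k p hp0 hp1 hp Ω _ μ _ X hX hμ
    have hR := hmap k (1 - ε ^ 2 / (2 * 2 ^ k))
    generalize highSet (μ0 k) k (X0 k) (1 - ε ^ 2 / (2 * 2 ^ k)) = R at hR ⊢
    have hmain := l1_polarPart_le (A := R.map Fin.valEmbedding) hp0 hp1 hpκ0 hpκh
      (hpκ.trans_lt hκ1) (hpκ.trans_le hp) hε0 hε1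
      (hR ▸ Finset.filter_subset _ _) (fun j hj => by
        rw [hR] at hj; exact (Finset.mem_filter.1 hj).2)
    rw [Finset.card_map] at hmain
    refine le_of_eq_of_le ?_ hmain
    let e : {j // j ∈ R} ≃ {j // j ∈ R.map Fin.valEmbedding} := R.equivMap Fin.valEmbedding
    refine Fintype.sum_equiv (e.arrowCongr (Equiv.refl _)) _ _ fun v => ?_
    rw [← measure_preimage_eq_mass hp0 hp1 hX hμ]
    congr 4
    ext ω
    rw [Set.mem_ofPred_eq, Set.mem_preimage, Set.mem_singleton_iff, funext_iff,
      ← e.forall_congr_right]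
    simp [polarPart, vecMul_G, e]
  · rw [← hpκ]
    refine (tendsto_levelAvg_polarEnt hpκ0.le hpκ1 hε0 hε1).congr fun k => ?_
    rw [levelAvg_indicator, ← hmap, Finset.card_map]
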